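/- Let R be an ergodic measure-preserving system and let B be a set of pairwise disjoint measure-preserving systems. Then R is disjoint from all but at most countably many elements of B. -/

import Mathlib

open MeasureTheory

/-- A measure-preserving system: an automorphism of a standard Borel probability
space. -/
structure MPS where
  X : Type
  mX : MeasurableSpace X
  sb : @StandardBorelSpace X mX
  μ : @Measure X mX
  T : X → X
  prob : @IsProbabilityMeasure X mX μ
  mp : @MeasurePreserving X X mX mX T μ μ

attribute [instance] MPS.mX MPS.sb MPS.prob

/-- `lam` is a joining of the systems `S₁` and `S₂`. -/
def MPS.IsJoining (S₁ S₂ : MPS) (lam : Measure (S₁.X × S₂.X)) : Prop :=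
  IsProbabilityMeasure lam ∧ MeasurePreserving (Prod.map S₁.T S₂.T) lam lam ∧
    lam.map Prod.fst = S₁.μ ∧ lam.map Prod.snd = S₂.μ

/-- Two systems are disjoint if their only joining is the product measure. -/
def MPS.Disj (S₁ S₂ : MPS) : Prop :=
  ∀ lam : Measure (S₁.X × S₂.X), S₁.IsJoining S₂ lam → lam = S₁.μ.prod S₂.μ

/-- The class `A⊥` of systems disjoint from every member of `A`. -/
def MPS.perp (A : Set MPS) : Set MPS := {S | ∀ S' ∈ A, S.Disj S'}

/-- The system determined by a joining of two systems. -/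
def MPS.joinSys (S₁ S₂ : MPS) (lam : Measure (S₁.X × S₂.X))
    (h : S₁.IsJoining S₂ lam) : MPS :=
  ⟨S₁.X × S₂.X, inferInstance, inferInstance, lam, Prod.map S₁.T S₂.T, h.1, h.2.1⟩

/-- `S` is a multiplier of `A⊥`: it belongs to `A⊥` and every joining of `S` with a
member of `A⊥` yields again a member of `A⊥`. -/
def MPS.IsMultiplier (A : Set MPS) (S : MPS) : Prop :=
  S ∈ MPS.perp A ∧ ∀ S' ∈ MPS.perp A, ∀ lam, ∀ h : S.IsJoining S' lam,
    S.joinSys S' lam h ∈ MPS.perp A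

/-- `lam` is an `n`-fold self-joining of `S`. -/
def MPS.IsSelfJoining (S : MPS) (n : ℕ) (lam : Measure (Fin n → S.X)) : Prop :=
  IsProbabilityMeasure lam ∧ MeasurePreserving (fun x i => S.T (x i)) lam lam ∧
    ∀ i, lam.map (fun x => x i) = S.μ

/-- The system determined by an `n`-fold self-joining of `S`. -/
def MPS.selfJoinSys (S : MPS) (n : ℕ) (lam : Measure (Fin n → S.X))
    (h : S.IsSelfJoining n lam) : MPS :=
  ⟨Fin n → S.X, inferInstance, inferInstance, lam, fun x i => S.T (x i), h.1, h.2.1⟩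

/-- Isomorphism of measure-preserving systems. -/
def MPS.Isomorphic (S₁ S₂ : MPS) : Prop :=
  ∃ e : S₁.X ≃ S₂.X, Measurable e ∧ Measurable e.symm ∧
    MeasurePreserving e S₁.μ S₂.μ ∧
    (fun x => S₂.T (e x)) =ᵐ[S₁.μ] (fun x => e (S₁.T x))

/-- `S₂` is a factor of `S₁`. -/
def MPS.IsFactor (S₁ S₂ : MPS) : Prop :=
  ∃ F : S₁.X → S₂.X, MeasurePreserving F S₁.μ S₂.μ ∧
    (fun x => F (S₁.T x)) =ᵐ[S₁.μ] (fun x => S₂.T (F x))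

open ProbabilityTheory

/-- The kernel may be pulled back before forming the composition-product. -/
lemma map_compProd_comap {α β γ : Type*} [MeasurableSpace α] [MeasurableSpace β]
    [MeasurableSpace γ] (ρ : Measure α) [SFinite ρ] (κ : Kernel β γ) [IsSFiniteKernel κ]
    {g : α → β} (hg : Measurable g) :
    (ρ ⊗ₘ κ.comap g hg).map (Prod.map g id) = ρ.map g ⊗ₘ κ := by
  ext s hs
  rw [Measure.map_apply (by fun_prop) hs, Measure.compProd_apply (by measurability),
    Measure.compProd_apply hs, lintegral_map (Kernel.measurable_kernel_prodMk_left hs) hg]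
  rfl

lemma map_eval_zero_trajMeasure {Z : Type*} [MeasurableSpace Z] (μ : Measure Z)
    (κ : (n : ℕ) → Kernel ((i : Finset.Iic n) → Z) Z) [∀ n, IsMarkovKernel (κ n)] :
    (Kernel.trajMeasure (X := fun _ => Z) μ κ).map (fun x => x 0) = μ := by
  have h : (Kernel.trajMeasure (X := fun _ => Z) μ κ).map
      (Preorder.frestrictLe (π := fun _ => Z) 0) =
        μ.map (MeasurableEquiv.piUnique fun _ : Finset.Iic 0 => Z).symm := by
    rw [Kernel.trajMeasure, Measure.map_comp _ _ (by fun_prop), Kernel.traj_map_frestrictLe,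
      Kernel.partialTraj_self, Measure.id_comp]
  have hf : Measurable fun x : (i : Finset.Iic 0) → Z => x ⟨0, by simp⟩ := measurable_pi_apply _
  have h' := congrArg (Measure.map fun x : (i : Finset.Iic 0) → Z => x ⟨0, by simp⟩) h
  rw [Measure.map_map hf (by fun_prop), Measure.map_map hf (MeasurableEquiv.measurable _)] at h'
  exact h'.trans Measure.map_id

lemma map_eval_trajMeasure_compProd {Z : Type*} [MeasurableSpace Z] (μ : Measure Z)
    [IsProbabilityMeasure μ] (κ : Kernel Z Z) [IsMarkovKernel κ] (n : ℕ) :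
    (Kernel.trajMeasure (X := fun _ => Z) μ fun n => κ.comap
        (fun x : (i : Finset.Iic n) → Z => x ⟨n, by simp⟩) (measurable_pi_apply _)).map
        (fun z => z n) ⊗ₘ κ =
      (Kernel.trajMeasure (X := fun _ => Z) μ fun n => κ.comap
        (fun x : (i : Finset.Iic n) → Z => x ⟨n, by simp⟩) (measurable_pi_apply _)).map
        fun z => (z n, z (n + 1)) := by
  have hlast : Measurable fun x : (i : Finset.Iic n) → Z => x ⟨n, by simp⟩ :=
    measurable_pi_apply _
  have h := congrArg (Measure.map (Prod.map (fun x : (i : Finset.Iic n) → Z => x ⟨n, by simp⟩) id))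
    (Kernel.map_frestrictLe_trajMeasure_compProd_eq_map_trajMeasure
      (X := fun _ => Z) (μ₀ := μ) (a := n) (κ := fun n => κ.comap
        (fun x : (i : Finset.Iic n) → Z => x ⟨n, by simp⟩) (measurable_pi_apply _)))
  rw [map_compProd_comap, Measure.map_map hlast (by fun_prop),
    Measure.map_map (hlast.prodMap measurable_id) (by fun_prop)] at h
  exact h

lemma exists_markovChain_law {Z : Type*} [MeasurableSpace Z] (μ : Measure Z)
    [IsProbabilityMeasure μ] (κ : Kernel Z Z) [IsMarkovKernel κ] :
    ∃ P : Measure (ℕ → Z), P.map (fun z => z 0) = μ ∧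
      ∀ n, P.map (fun z => z n) ⊗ₘ κ = P.map fun z => (z n, z (n + 1)) :=
  ⟨_, map_eval_zero_trajMeasure μ _, map_eval_trajMeasure_compProd μ κ⟩

/-- `P` is the law of the backward orbits of the stationary system `(Z, T, μ)`: its coordinates
have law `μ`, and each is almost surely the image under `T` of the next one. -/
structure IsBackwardOrbitLaw {Z : Type*} [MeasurableSpace Z] (T : Z → Z) (μ : Measure Z)
    (P : Measure (ℕ → Z)) : Prop where
  map_eval : ∀ n, P.map (fun z => z n) = μ
  ae_eq : ∀ n, ∀ᵐ z ∂P, T (z (n + 1)) = z n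

namespace IsBackwardOrbitLaw

variable {Z W : Type*} [MeasurableSpace Z] [MeasurableSpace W] {T : Z → Z} {μ : Measure Z}

lemma isProbabilityMeasure [IsProbabilityMeasure μ] {P : Measure (ℕ → Z)}
    (h : IsBackwardOrbitLaw T μ P) : IsProbabilityMeasure P := by
  have : IsProbabilityMeasure (P.map fun z => z 0) := by rw [h.map_eval]; infer_instance
  exact Measure.isProbabilityMeasure_of_map fun z : ℕ → Z => z 0

theorem exists_law [StandardBorelSpace Z] [IsProbabilityMeasure μ]
    (hT : MeasurePreserving T μ μ) : ∃ P, IsBackwardOrbitLaw T μ P := by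
  have : Nonempty Z := nonempty_of_isProbabilityMeasure μ
  let κ : Kernel Z Z := condDistrib id T μ
  have hκ : μ ⊗ₘ κ = μ.map fun a => (T a, a) := by
    have h : μ.map T ⊗ₘ κ = μ.map fun a => (T a, id a) := compProd_map_condDistrib aemeasurable_id
    rwa [hT.map_eq] at h
  have hTid : Measurable fun a => (T a, a) := hT.measurable.prodMk measurable_id
  obtain ⟨P, hzero, hstep⟩ := exists_markovChain_law μ κ
  have hpair (n : ℕ) (h : P.map (fun z => z n) = μ) :
      P.map (fun z => (z n, z (n + 1))) = μ.map fun a => (T a, a) := by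
    rw [← hstep, h, hκ]
  have heval (n : ℕ) : P.map (fun z => z n) = μ := by
    induction n with
    | zero => exact hzero
    | succ n ih =>
      have h := congrArg (Measure.map Prod.snd) (hpair n ih)
      rw [Measure.map_map (by fun_prop) (by fun_prop),
        Measure.map_map (by fun_prop) hTid] at h
      exact h.trans Measure.map_id
  refine ⟨P, heval, fun n => ?_⟩
  have h : ∀ᵐ p ∂(P.map fun z => (z n, z (n + 1))), T p.2 = p.1 := by
    rw [hpair n (heval n), ae_map_iff hTid.aemeasurable
      (measurableSet_eq_fun (f := fun p : Z × Z => T p.2) (hT.measurable.comp measurable_snd)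
        measurable_fst)]
    exact .of_forall fun _ => rfl
  exact ae_of_ae_map (by fun_prop) h

lemma ae_eq_iterate {P : Measure (ℕ → Z)} (h : IsBackwardOrbitLaw T μ P) :
    ∀ᵐ z ∂P, ∀ n k, T^[k] (z (n + k)) = z n := by
  filter_upwards [ae_all_iff.2 h.ae_eq] with z hz n k
  induction k with
  | zero => rfl
  | succ k ih => rw [Function.iterate_succ_apply, ← add_assoc, hz, ih]

theorem unique [IsProbabilityMeasure μ] (hT : Measurable T) {P Q : Measure (ℕ → Z)}
    (hP : IsBackwardOrbitLaw T μ P) (hQ : IsBackwardOrbitLaw T μ Q) : P = Q := by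
  let F (I : Finset ℕ) (a : Z) (i : I) : Z := T^[I.sup id - i] a
  have hF (I : Finset ℕ) : Measurable (F I) := measurable_pi_lambda _ fun i => hT.iterate _
  have key {P : Measure (ℕ → Z)} (hP : IsBackwardOrbitLaw T μ P) :
      IsProjectiveLimit P fun I => μ.map (F I) := by
    intro I
    dsimp only
    rw [← hP.map_eval (I.sup id), Measure.map_map (hF I) (by fun_prop)]
    refine Measure.map_congr ?_
    filter_upwards [hP.ae_eq_iterate] with z hz
    ext i
    have hi : (i : ℕ) ≤ I.sup id := Finset.le_sup (f := id) i.2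
    have := hz i (I.sup id - i)
    rw [Nat.add_sub_cancel' hi] at this
    exact this.symm
  exact (key hP).unique (key hQ)

lemma map_semiconj [StandardBorelSpace W] {S : W → W} {f : Z → W} (hS : Measurable S)
    (hf : Measurable f)
    (hfT : ∀ z, f (T z) = S (f z)) {P : Measure (ℕ → Z)} (h : IsBackwardOrbitLaw T μ P) :
    IsBackwardOrbitLaw S (μ.map f) (P.map fun z n => f (z n)) := by
  have hm : Measurable fun (z : ℕ → Z) n => f (z n) := by fun_prop
  refine ⟨fun n => ?_, fun n => ?_⟩
  · rw [Measure.map_map (by fun_prop) hm, ← h.map_eval n, Measure.map_map hf (by fun_prop)]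
    rfl
  · rw [ae_map_iff hm.aemeasurable (measurableSet_eq_fun (f := fun w : ℕ → W => S (w (n + 1)))
      (hS.comp (measurable_pi_apply _)) (measurable_pi_apply _))]
    filter_upwards [h.ae_eq n] with z hz
    rw [← hfT, hz]

end IsBackwardOrbitLaw

/-- Extends a backward orbit of `T` one step into the future. -/
def forwardShift {Z : Type*} (T : Z → Z) (z : ℕ → Z) : ℕ → Z
  | 0 => T (z 0)
  | n + 1 => z n

@[fun_prop]
lemma measurable_forwardShift {Z : Type*} [MeasurableSpace Z] {T : Z → Z} (hT : Measurable T) :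
    Measurable (forwardShift T) := by
  refine measurable_pi_lambda _ fun n => ?_
  cases n with
  | zero => exact hT.comp (measurable_pi_apply 0)
  | succ n => exact measurable_pi_apply n

lemma IsBackwardOrbitLaw.measurePreserving_forwardShift {Z : Type*} [MeasurableSpace Z]
    [StandardBorelSpace Z] {T : Z → Z} {μ : Measure Z}
    [IsProbabilityMeasure μ] (hT : MeasurePreserving T μ μ) {P : Measure (ℕ → Z)}
    (h : IsBackwardOrbitLaw T μ P) : MeasurePreserving (forwardShift T) P P := by
  have hm := measurable_forwardShift hT.measurable
  refine ⟨hm, IsBackwardOrbitLaw.unique hT.measurable ⟨fun n => ?_, fun n => ?_⟩ h⟩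
  · rw [Measure.map_map (by fun_prop) hm]
    cases n with
    | zero =>
      conv_rhs => rw [← hT.map_eq, ← h.map_eval 0,
        Measure.map_map hT.measurable (measurable_pi_apply 0)]
      rfl
    | succ n => exact h.map_eval n
  · rw [ae_map_iff hm.aemeasurable (measurableSet_eq_fun (f := fun z : ℕ → Z => T (z (n + 1)))
      (hT.measurable.comp (measurable_pi_apply _)) (measurable_pi_apply _))]
    cases n with
    | zero => exact .of_forall fun _ => rfl
    | succ n => exact h.ae_eq n

/-- The disintegration of an invariant measure along an invertible factor is equivariant. -/
lemma condKernel_apply_eq_map {X Y : Type*} [MeasurableSpace X] [MeasurableSpace Y]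
    [StandardBorelSpace Y] [Nonempty Y] {θ τ : X → X} {S : Y → Y} (hθ : Measurable θ)
    (hτ : Measurable τ) (hτθ : Function.LeftInverse τ θ) (hS : Measurable S)
    {ν : Measure (X × Y)} [IsFiniteMeasure ν] (hν : MeasurePreserving (Prod.map θ S) ν ν) :
    ∀ᵐ x ∂ν.fst, ν.condKernel (θ x) = (ν.condKernel x).map S := by
  have hfst : MeasurePreserving θ ν.fst ν.fst := by
    refine ⟨hθ, ?_⟩
    conv_rhs => rw [Measure.fst, ← hν.map_eq, Measure.map_map measurable_fst hν.measurable]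
    rw [Measure.fst, Measure.map_map hθ measurable_fst]
    rfl
  let κ : Kernel X Y := (ν.condKernel.map S).comap τ hτ
  have hκ : κ.comap θ hθ = ν.condKernel.map S := by
    ext1 x
    simp [κ, Kernel.comap_apply, hτθ x]
  have h : ν = ν.fst ⊗ₘ κ := by
    conv_rhs => rw [← hfst.map_eq, ← map_compProd_comap _ _ hθ, hκ, Measure.compProd_map hS,
      ν.disintegrate, Measure.map_map (by fun_prop) (by fun_prop)]
    exact hν.map_eq.symm
  filter_upwards [hfst.quasiMeasurePreserving.ae (eq_condKernel_of_measure_eq_compProd κ h)]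
    with x hx
  rw [← hx, Kernel.comap_apply, hτθ x, Kernel.map_apply _ hS]

/-- Two equivariant kernels over a common base yield an invariant relative product. -/
lemma measurePreserving_comp_prod {X Y Z : Type*} [MeasurableSpace X] [MeasurableSpace Y]
    [MeasurableSpace Z] {m : Measure X} {θ : X → X} (hθ : MeasurePreserving θ m m)
    {S : Y → Y} {R : Z → Z} (hS : Measurable S) (hR : Measurable R)
    {κ : Kernel X Y} {η : Kernel X Z} [IsMarkovKernel κ] [IsMarkovKernel η]
    (hκ : ∀ᵐ x ∂m, κ (θ x) = (κ x).map S) (hη : ∀ᵐ x ∂m, η (θ x) = (η x).map R) :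
    MeasurePreserving (Prod.map S R) ((κ ×ₖ η) ∘ₘ m) ((κ ×ₖ η) ∘ₘ m) := by
  have hSR : Measurable (Prod.map S R) := hS.prodMap hR
  refine ⟨hSR, ?_⟩
  conv_rhs => rw [← hθ.map_eq]
  rw [Measure.map_comp _ _ hSR, ← Measure.deterministic_comp_eq_map hθ.measurable,
    Measure.comp_assoc]
  refine Measure.comp_congr ?_
  filter_upwards [hκ, hη] with x h₁ h₂
  rw [Kernel.map_apply _ hSR, Kernel.prod_apply, ← Measure.map_prod_map _ _ hS hR, ← h₁, ← h₂,
    Kernel.comp_deterministic_eq_comap, Kernel.comap_apply, Kernel.prod_apply]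

lemma integral_measureReal_eq {X Y : Type*} [MeasurableSpace X] [MeasurableSpace Y]
    {m : Measure X} (κ : Kernel X Y) [IsMarkovKernel κ] {A : Set Y} (hA : MeasurableSet A) :
    ∫ x, (κ x).real A ∂m = (κ ∘ₘ m).real A := by
  simp_rw [measureReal_def]
  rw [integral_toReal (κ.measurable_coe hA).aemeasurable (.of_forall fun _ => measure_lt_top _ _),
    Measure.bind_apply hA κ.aemeasurable]

lemma countable_of_pairwise_inner_eq_zero {ι E : Type*} [NormedAddCommGroup E]
    [InnerProductSpace ℝ E] [TopologicalSpace.SeparableSpace E] {v : ι → E} (hv : ∀ i, v i ≠ 0)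
    (h : Pairwise fun i j => inner ℝ (v i) (v j) = 0) : Countable ι := by
  rw [← Set.countable_univ_iff]
  refine Set.PairwiseDisjoint.countable_of_isOpen
    (s := fun i => Metric.ball (v i) (‖v i‖ / 2)) ?_ (fun _ _ => Metric.isOpen_ball)
    fun i _ => Metric.nonempty_ball.2 (half_pos (norm_pos_iff.2 (hv i)))
  intro i _ j _ hij
  refine Metric.ball_disjoint_ball ?_
  have hsq := norm_sub_sq_real (v i) (v j)
  rw [h hij] at hsq
  rw [dist_eq_norm]
  nlinarith [norm_nonneg (v i), norm_nonneg (v j), norm_nonneg (v i - v j),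
    sq_nonneg (‖v i‖ - ‖v j‖)]

/-- A system which is not disjoint from `R` has, over the backward orbits of `R`, an equivariant
kernel which is not almost surely constant. -/
lemma MPS.exists_equivariant_kernel_of_not_disj {R S : MPS} {m : Measure (ℕ → R.X)}
    (hm : IsBackwardOrbitLaw R.T R.μ m) (h : ¬ R.Disj S) :
    ∃ κ : Kernel (ℕ → R.X) S.X, IsMarkovKernel κ ∧ κ ∘ₘ m = S.μ ∧
      (∀ᵐ x ∂m, κ (forwardShift R.T x) = (κ x).map S.T) ∧
      ∃ A, MeasurableSet A ∧ ¬ ∀ᵐ x ∂m, κ x A = S.μ A := by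
  simp only [MPS.Disj, not_forall] at h
  obtain ⟨lam, ⟨hprob, hlam, hfst, hsnd⟩, hne⟩ := h
  have hR := R.mp.measurable
  have hS := S.mp.measurable
  have : Nonempty S.X := nonempty_of_isProbabilityMeasure S.μ
  have := hm.isProbabilityMeasure
  obtain ⟨P, hP⟩ := IsBackwardOrbitLaw.exists_law hlam
  have := hP.isProbabilityMeasure
  let f (z : ℕ → R.X × S.X) : (ℕ → R.X) × S.X := (fun n => (z n).1, (z 0).2)
  have hf : Measurable f := by fun_prop
  let ν := P.map f
  have : IsProbabilityMeasure ν := Measure.isProbabilityMeasure_map hf.aemeasurable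
  have hνfst : ν.fst = m := by
    refine IsBackwardOrbitLaw.unique hR ?_ hm
    rw [Measure.fst, Measure.map_map measurable_fst hf, ← hfst]
    exact hP.map_semiconj hR measurable_fst fun _ => rfl
  have hνlam : ν.map (Prod.map (fun x => x 0) id) = lam := by
    rw [Measure.map_map (by fun_prop) hf]
    exact hP.map_eval 0
  have hνsnd : ν.snd = S.μ := by
    rw [← hsnd, ← hνlam, Measure.map_map (by fun_prop) (by fun_prop)]
    rfl
  have hνinv : MeasurePreserving (Prod.map (forwardShift R.T) S.T) ν ν := by
    have hinv := hP.measurePreserving_forwardShift hlam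
    have hm' : Measurable (Prod.map (forwardShift R.T) S.T) :=
      (measurable_forwardShift hR).prodMap hS
    refine ⟨hm', ?_⟩
    conv_rhs => rw [show ν = P.map f from rfl, ← hinv.map_eq, Measure.map_map hf hinv.measurable]
    rw [Measure.map_map hm' hf]
    congr 1
    funext z
    refine Prod.ext (funext fun n => ?_) rfl
    cases n <;> rfl
  refine ⟨ν.condKernel, inferInstance, ?_, ?_, ?_⟩
  · rw [← hνsnd, ← hνfst, ← Measure.snd_compProd, ν.disintegrate]
  · rw [← hνfst]
    exact condKernel_apply_eq_map (τ := fun x n => x (n + 1)) (measurable_forwardShift hR)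
      (by fun_prop) (fun _ => rfl) hS hνinv
  · by_contra! hconst
    refine hne ?_
    have hprod : ν = m.prod S.μ := by
      refine (Measure.prod_eq fun s t hs ht => ?_).symm
      rw [← ν.disintegrate ν.condKernel, hνfst, Measure.compProd_apply_prod hs ht,
        setLIntegral_congr_fun_ae hs ((hconst t ht).mono fun x hx _ => hx), setLIntegral_const,
        mul_comm]
    rw [← hνlam, hprod, ← Measure.map_prod_map _ _ (by fun_prop) (by fun_prop), hm.map_eval,
      Measure.map_id]

/-- Let `R` be an ergodic measure-preserving system and let `B` be a
set of pairwise disjoint measure-preserving systems. Then `R` is disjoint from all but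
at most countably many elements of `B`. -/
theorem ergodic_disjoint_from_all_but_countably_many
    (R : MPS) (hR : Ergodic R.T R.μ)
    (B : Set MPS)
    (hB : ∀ S₁ ∈ B, ∀ S₂ ∈ B, S₁ ≠ S₂ → S₁.Disj S₂) :
    Set.Countable {S ∈ B | ¬ R.Disj S} := by
  obtain ⟨m, hm⟩ := IsBackwardOrbitLaw.exists_law R.mp
  have := hm.isProbabilityMeasure
  choose κ hκ hκμ hκT A hA hκA using fun S : {S ∈ B | ¬ R.Disj S} =>
    MPS.exists_equivariant_kernel_of_not_disj hm S.2.2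
  let g (S : {S ∈ B | ¬ R.Disj S}) (x : ℕ → R.X) : ℝ := (κ S x).real (A S) - S.1.μ.real (A S)
  have hmeas (S) : Measurable fun x => (κ S x).real (A S) :=
    ((κ S).measurable_coe (hA S)).ennreal_toReal
  have hbound (S) : ∀ᵐ x ∂m, ‖(κ S x).real (A S)‖ ≤ 1 := .of_forall fun x => by
    rw [Real.norm_of_nonneg measureReal_nonneg]
    exact measureReal_le_one
  have hLp (S) : MemLp (fun x => (κ S x).real (A S)) 2 m :=
    .of_bound (hmeas S).aestronglyMeasurable 1 (hbound S)
  have hmean (S) : ∫ x, (κ S x).real (A S) ∂m = S.1.μ.real (A S) := by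
    rw [integral_measureReal_eq _ (hA S), hκμ]
  have hg (S) : MemLp (g S) 2 m := (hLp S).sub (memLp_const _)
  have : Fact ((2 : ENNReal) ≠ ⊤) := ⟨by norm_num⟩
  refine countable_of_pairwise_inner_eq_zero (v := fun S => (hg S).toLp) (fun S h0 => ?_) ?_
  · refine hκA S ?_
    filter_upwards [(hg S).coeFn_toLp, (Lp.eq_zero_iff_ae_eq_zero).1 h0] with x h₁ h₂
    rw [h₁] at h₂
    exact (measureReal_eq_measureReal_iff (measure_ne_top _ _) (measure_ne_top _ _)).1
      (sub_eq_zero.1 h₂)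
  · intro S S' hSS'
    have hprod : (κ S ×ₖ κ S') ∘ₘ m = S.1.μ.prod S'.1.μ := by
      refine hB S S.2.1 S' S'.2.1 (Subtype.coe_ne_coe.2 hSS') _ ⟨inferInstance,
        measurePreserving_comp_prod (hm.measurePreserving_forwardShift R.mp)
          S.1.mp.measurable S'.1.mp.measurable (hκT S) (hκT S'), ?_, ?_⟩
      · rw [Measure.map_comp _ _ measurable_fst, ← Kernel.fst_eq, Kernel.fst_prod, hκμ]
      · rw [Measure.map_comp _ _ measurable_snd, ← Kernel.snd_eq, Kernel.snd_prod, hκμ]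
    have hmul : ∫ x, (κ S x).real (A S) * (κ S' x).real (A S') ∂m =
        S.1.μ.real (A S) * S'.1.μ.real (A S') := by
      rw [← measureReal_prod_prod, ← hprod, ← integral_measureReal_eq _ ((hA S).prod (hA S'))]
      simp_rw [Kernel.prod_apply, measureReal_prod_prod]
    calc inner ℝ ((hg S).toLp) ((hg S').toLp)
      _ = cov[fun x => (κ S x).real (A S), fun x => (κ S' x).real (A S'); m] := by
        rw [L2.inner_def, covariance, hmean, hmean]
        refine integral_congr_ae ?_
        filter_upwards [(hg S).coeFn_toLp, (hg S').coeFn_toLp] with x h₁ h₂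
        rw [h₁, h₂, RCLike.inner_apply, conj_trivial, mul_comm]
      _ = 0 := by
        rw [covariance_eq_sub (hLp S) (hLp S'), hmean, hmean, sub_eq_zero]
        exact hmul
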